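/- Let d ≥ 1, R > 0, β > 1, r > R + 1 and b > R + r. There exist λ₀ ≥ 1 and a constant C₂ > 0, depending only on β, r, R, b, d, such that for every λ > λ₀ and every u ∈ C²(closure Ω) with u = 0 on ∂Ω, one has − ∫_Ω e^{2λ((z+r)/b)^β} u Δu dx ≥ −C₂ λ² β² b^{−2β} ∫_Ω (z+r)^{2β} e^{2λ((z+r)/b)^β} u² dx + ∫_Ω e^{2λ((z+r)/b)^β} |∇u|² dx. -/

import Mathlib

open MeasureTheory Real

noncomputable section

/-- The open cube `Ω = (-R, R)^d` (here the dimension is `d + 1 ≥ 1`). -/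
def Omega (d : ℕ) (R : ℝ) : Set (EuclideanSpace ℝ (Fin (d + 1))) :=
  {x | ∀ i, x i ∈ Set.Ioo (-R) R}

/-- The Laplacian `Δu = ∑ i, ∂²u/∂xᵢ²`. -/
def lap (d : ℕ) (u : EuclideanSpace ℝ (Fin (d + 1)) → ℝ)
    (x : EuclideanSpace ℝ (Fin (d + 1))) : ℝ :=
  ∑ i : Fin (d + 1),
    fderiv ℝ (fun y => fderiv ℝ u y (EuclideanSpace.single i 1)) x (EuclideanSpace.single i 1)

/-- The Carleman weight function `x ↦ exp (2 λ ((z + r)/b)^β)`. -/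
def cw (d : ℕ) (lam β r b : ℝ) (x : EuclideanSpace ℝ (Fin (d + 1))) : ℝ :=
  Real.exp (2 * lam * ((x (Fin.last d) + r) / b) ^ β)

/-- The closed cube `[-R, R]^(d+1)`. -/
def closedCube (d : ℕ) (R : ℝ) : Set (EuclideanSpace ℝ (Fin (d + 1))) :=
  {x | ∀ i, x i ∈ Set.Icc (-R) R}

lemma isCompact_closedCube (d : ℕ) (R : ℝ) : IsCompact (closedCube d R) := by
  have h : closedCube d R = (EuclideanSpace.equiv (Fin (d + 1)) ℝ).toHomeomorph ⁻¹'
      (Set.univ.pi fun _ => Set.Icc (-R) R) := by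
    ext x; simp only [closedCube, Set.mem_ofPred_eq, Set.mem_preimage, Set.mem_univ_pi]; rfl
  rw [h]
  exact (Homeomorph.isCompact_preimage _).2 (isCompact_univ_pi fun _ => isCompact_Icc)

lemma Omega_eq_preimage (d : ℕ) (R : ℝ) :
    Omega d R = (EuclideanSpace.equiv (Fin (d + 1)) ℝ).toHomeomorph ⁻¹'
      (Set.univ.pi fun _ => Set.Ioo (-R) R) := by
  ext x; simp [Omega, Set.mem_pi, -Set.mem_Ioo]

lemma isOpen_Omega (d : ℕ) (R : ℝ) : IsOpen (Omega d R) := by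
  rw [Omega_eq_preimage]
  exact (isOpen_set_pi Set.finite_univ fun _ _ => isOpen_Ioo).preimage
    (Homeomorph.continuous _)

lemma Omega_subset_closedCube (d : ℕ) (R : ℝ) : Omega d R ⊆ closedCube d R :=
  fun _ hx i => Set.Ioo_subset_Icc_self (hx i)

lemma mem_frontier_Omega {d : ℕ} {R : ℝ} (hR : 0 < R) {x : EuclideanSpace ℝ (Fin (d + 1))}
    (hx : x ∈ closedCube d R) (hx' : x ∉ Omega d R) : x ∈ frontier (Omega d R) := by
  rw [(isOpen_Omega d R).frontier_eq]
  refine ⟨?_, hx'⟩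
  rw [Omega_eq_preimage, ← Homeomorph.preimage_closure, closure_pi_set,
    closure_Ioo (by linarith)]
  exact fun i _ => hx i

lemma integrableOn_Omega {d : ℕ} {R : ℝ} {f : EuclideanSpace ℝ (Fin (d + 1)) → ℝ}
    (hf : ContinuousOn f (closedCube d R)) : IntegrableOn f (Omega d R) :=
  (hf.integrableOn_compact (isCompact_closedCube d R)).mono_set (Omega_subset_closedCube d R)

/-- The divergence theorem on the cube for a vector field vanishing on the boundary. -/
lemma integral_divergence_Omega_eq_zero {d : ℕ} {R : ℝ} (hR : 0 < R)
    (F : Fin (d + 1) → EuclideanSpace ℝ (Fin (d + 1)) → ℝ)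
    (F' : Fin (d + 1) → EuclideanSpace ℝ (Fin (d + 1)) → EuclideanSpace ℝ (Fin (d + 1)) →L[ℝ] ℝ)
    (hF : ∀ i, ∀ x ∈ closedCube d R, HasFDerivAt (F i) (F' i x) x)
    (hdiv : ContinuousOn (fun x => ∑ i, F' i x (EuclideanSpace.single i 1)) (closedCube d R))
    (h0 : ∀ i, ∀ x ∈ frontier (Omega d R), F i x = 0) :
    ∫ x in Omega d R, ∑ i, F' i x (EuclideanSpace.single i 1) = 0 := by
  let L := (EuclideanSpace.equiv (Fin (d + 1)) ℝ).symm
  have hmem : ∀ y, y ∈ Set.Icc (fun _ : Fin (d + 1) => -R) (fun _ => R) → L y ∈ closedCube d R :=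
    fun y hy i => ⟨hy.1 i, hy.2 i⟩
  have hcont : ContinuousOn (fun y => ∑ i, F' i (L y) (EuclideanSpace.single i 1))
      (Set.Icc (fun _ : Fin (d + 1) => -R) (fun _ => R)) :=
    hdiv.comp L.continuous.continuousOn hmem
  have key := integral_divergence_of_hasFDerivAt_off_countable'
    (fun _ : Fin (d + 1) => -R) (fun _ => R) (fun _ => by linarith)
    (fun i y => F i (L y)) (fun i y => (F' i (L y)).comp (L : _ →L[ℝ] _)) ∅ Set.countable_empty
    (fun i y hy => ((hF i _ (hmem y hy)).continuousAt.comp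
      L.continuous.continuousAt).continuousWithinAt)
    (fun y hy i => (hF i (L y) (hmem y ⟨fun j => (hy.1 j trivial).1.le,
      fun j => (hy.1 j trivial).2.le⟩)).comp y L.hasFDerivAt)
    (hcont.integrableOn_compact isCompact_Icc)
  have hface : ∀ (i : Fin (d + 1)) (c : ℝ), (c = R ∨ c = -R) →
      ∫ x in Set.Icc ((fun _ : Fin (d + 1) => -R) ∘ i.succAbove) ((fun _ => R) ∘ i.succAbove),
        F i (L (i.insertNth c x)) = 0 := by
    intro i c hc
    refine setIntegral_eq_zero_of_forall_eq_zero fun x hx => h0 i _ (mem_frontier_Omega hR ?_ ?_)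
    · refine hmem _ ?_
      rw [Set.mem_Icc, Fin.le_insertNth_iff, Fin.insertNth_le_iff]
      refine ⟨⟨?_, hx.1⟩, ?_, hx.2⟩ <;> rcases hc with rfl | rfl <;> linarith
    · intro h
      have := h i
      simp only [L, EuclideanSpace.equiv, PiLp.continuousLinearEquiv_symm_apply,
        Fin.insertNth_apply_same] at this
      rcases hc with rfl | rfl
      · exact lt_irrefl _ this.2
      · exact lt_irrefl _ this.1
  have hset : Omega d R = (WithLp.ofLp) ⁻¹' (Set.univ.pi fun _ : Fin (d + 1) => Set.Ioo (-R) R) := by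
    ext x; simp [Omega, Set.mem_pi, -Set.mem_Ioo]
  have htrans := (PiLp.volume_preserving_ofLp (Fin (d + 1))).setIntegral_preimage_emb
    (MeasurableEquiv.toLp 2 (Fin (d + 1) → ℝ)).symm.measurableEmbedding
    (fun y => ∑ i, F' i (L y) (EuclideanSpace.single i 1))
    (Set.univ.pi fun _ : Fin (d + 1) => Set.Ioo (-R) R)
  rw [← hset] at htrans
  refine htrans.trans ?_
  rw [volume_pi, setIntegral_congr_set Measure.univ_pi_Ioo_ae_eq_Icc, ← volume_pi]
  refine Eq.trans ?_ (key.trans (Finset.sum_eq_zero fun i _ => ?_))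
  · refine integral_congr_ae (Filter.Eventually.of_forall fun y => ?_)
    refine Finset.sum_congr rfl fun i _ => ?_
    simp [L, EuclideanSpace.equiv]
  · rw [hface i R (Or.inl rfl), hface i (-R) (Or.inr rfl), sub_zero]

lemma norm_gradient_sq {d : ℕ} (u : EuclideanSpace ℝ (Fin (d + 1)) → ℝ)
    (x : EuclideanSpace ℝ (Fin (d + 1))) :
    ‖gradient u x‖ ^ 2 = ∑ i, (fderiv ℝ u x (EuclideanSpace.single i 1)) ^ 2 := by
  rw [EuclideanSpace.real_norm_sq_eq]
  refine Finset.sum_congr rfl fun i _ => ?_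
  rw [← toDual_gradient, InnerProductSpace.toDual_apply_apply, EuclideanSpace.inner_single_right]
  simp

/-- Green's identity for `u Δu` with a weight depending only on the last coordinate. -/
lemma integral_weight_mul_lap {d : ℕ} {R : ℝ} (hR : 0 < R) {g g₁ g₂ : ℝ → ℝ}
    (hg : ∀ t ∈ Set.Icc (-R) R, HasDerivAt g (g₁ t) t)
    (hg₁ : ∀ t ∈ Set.Icc (-R) R, HasDerivAt g₁ (g₂ t) t)
    (hg₂ : ContinuousOn g₂ (Set.Icc (-R) R))
    {u : EuclideanSpace ℝ (Fin (d + 1)) → ℝ} (hu : ContDiff ℝ 2 u)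
    (hu0 : ∀ x ∈ frontier (Omega d R), u x = 0) :
    -∫ x in Omega d R, g (x (Fin.last d)) * u x * lap d u x =
      (∫ x in Omega d R, g (x (Fin.last d)) * ‖gradient u x‖ ^ 2) -
        ∫ x in Omega d R, g₂ (x (Fin.last d)) / 2 * u x ^ 2 := by
  have hlast : ∀ x ∈ closedCube d R, x (Fin.last d) ∈ Set.Icc (-R) R := fun x hx => hx _
  have hcl : Continuous fun x : EuclideanSpace ℝ (Fin (d + 1)) => x (Fin.last d) := by fun_prop
  have cg : ContinuousOn (fun x : EuclideanSpace ℝ (Fin (d + 1)) => g (x (Fin.last d)))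
      (closedCube d R) :=
    ContinuousOn.comp (fun t ht => (hg t ht).continuousAt.continuousWithinAt)
      hcl.continuousOn hlast
  have cg₂ : ContinuousOn (fun x : EuclideanSpace ℝ (Fin (d + 1)) => g₂ (x (Fin.last d)))
      (closedCube d R) := hg₂.comp hcl.continuousOn hlast
  have hdu : ∀ v, ContDiff ℝ 1 (fun y => fderiv ℝ u y v) := fun v =>
    (hu.fderiv_right (m := 1) (by norm_num)).clm_apply contDiff_const
  have clap : Continuous (lap d u) := by
    unfold lap
    exact continuous_finsetSum _ fun i _ =>
      ((hdu _).continuous_fderiv one_ne_zero).clm_apply continuous_const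
  have cu : Continuous u := hu.continuous
  have cgrad : Continuous fun x => ‖gradient u x‖ ^ 2 := by
    simp only [norm_gradient_sq]
    exact continuous_finsetSum _ fun i _ => (hdu _).continuous.pow 2
  let pr : EuclideanSpace ℝ (Fin (d + 1)) →L[ℝ] ℝ := EuclideanSpace.proj (Fin.last d)
  let e : Fin (d + 1) → EuclideanSpace ℝ (Fin (d + 1)) := fun i => EuclideanSpace.single i 1
  let c : Fin (d + 1) → ℝ := fun i => if i = Fin.last d then 1 else 0
  have hpr : ∀ i, pr (e i) = c i := by
    intro i
    simp [pr, e, c, PiLp.single_apply, eq_comm]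
  let F : Fin (d + 1) → EuclideanSpace ℝ (Fin (d + 1)) → ℝ := fun i x =>
    g (pr x) * u x * fderiv ℝ u x (e i) - c i / 2 * (g₁ (pr x) * (u x * u x))
  let F' : Fin (d + 1) → EuclideanSpace ℝ (Fin (d + 1)) →
      EuclideanSpace ℝ (Fin (d + 1)) →L[ℝ] ℝ := fun i x =>
    ((g (pr x) * u x) • fderiv ℝ (fun y => fderiv ℝ u y (e i)) x +
      fderiv ℝ u x (e i) • (g (pr x) • fderiv ℝ u x + u x • (g₁ (pr x) • pr))) -
    (c i / 2) • (g₁ (pr x) • (u x • fderiv ℝ u x + u x • fderiv ℝ u x) +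
      (u x * u x) • (g₂ (pr x) • pr))
  have hF : ∀ i, ∀ x ∈ closedCube d R, HasFDerivAt (F i) (F' i x) x := by
    intro i x hx
    have h1 : HasFDerivAt u (fderiv ℝ u x) x :=
      (hu.differentiable two_ne_zero x).hasFDerivAt
    have h2 : HasFDerivAt (fun y => fderiv ℝ u y (e i))
        (fderiv ℝ (fun y => fderiv ℝ u y (e i)) x) x :=
      ((hdu (e i)).differentiable one_ne_zero x).hasFDerivAt
    have h3 : HasFDerivAt (fun y => g (pr y)) (g₁ (pr x) • pr) x :=
      (hg _ (hlast x hx)).comp_hasFDerivAt x pr.hasFDerivAt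
    have h4 : HasFDerivAt (fun y => g₁ (pr y)) (g₂ (pr x) • pr) x :=
      (hg₁ _ (hlast x hx)).comp_hasFDerivAt x pr.hasFDerivAt
    exact ((h3.mul h1).mul h2).sub ((h4.mul (h1.mul h1)).const_mul (c i / 2))
  have hsum : ∀ x, ∑ i, F' i x (e i) = g (x (Fin.last d)) * u x * lap d u x +
      g (x (Fin.last d)) * ‖gradient u x‖ ^ 2 - g₂ (x (Fin.last d)) / 2 * u x ^ 2 := by
    intro x
    have hpt : ∀ i, F' i x (e i) =
        g (pr x) * u x * fderiv ℝ (fun y => fderiv ℝ u y (e i)) x (e i) +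
        g (pr x) * fderiv ℝ u x (e i) ^ 2 - c i * (g₂ (pr x) / 2 * u x ^ 2) := by
      intro i
      have hc : c i * c i = c i := by simp [c]
      simp only [F', sub_apply, add_apply,
        smul_apply, smul_eq_mul, hpr]
      linear_combination (-(1 / 2) * u x ^ 2 * g₂ (pr x)) * hc
    rw [Finset.sum_congr rfl fun i _ => hpt i, Finset.sum_sub_distrib, Finset.sum_add_distrib,
      ← Finset.mul_sum, ← Finset.mul_sum, ← Finset.sum_mul, norm_gradient_sq]
    simp [c, lap, e, pr]
  have c1 : ContinuousOn (fun x => g (x (Fin.last d)) * u x * lap d u x) (closedCube d R) :=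
    (cg.mul cu.continuousOn).mul clap.continuousOn
  have c2 : ContinuousOn (fun x => g (x (Fin.last d)) * ‖gradient u x‖ ^ 2) (closedCube d R) :=
    cg.mul cgrad.continuousOn
  have c12 : ContinuousOn (fun x => g (x (Fin.last d)) * u x * lap d u x +
      g (x (Fin.last d)) * ‖gradient u x‖ ^ 2) (closedCube d R) := c1.add c2
  have c3 : ContinuousOn (fun x => g₂ (x (Fin.last d)) / 2 * u x ^ 2) (closedCube d R) :=
    (cg₂.div_const 2).mul (cu.pow 2).continuousOn
  have key := integral_divergence_Omega_eq_zero hR F F' hF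
    ((c12.sub c3).congr fun x _ => hsum x)
    (fun i x hx => by simp [F, hu0 x hx])
  rw [integral_congr_ae (Filter.Eventually.of_forall hsum),
    integral_sub (integrableOn_Omega c12) (integrableOn_Omega c3),
    integral_add (integrableOn_Omega c1) (integrableOn_Omega c2)] at key
  linarith

/-- lower bound for `-∫_Ω e^{2λ((z+r)/b)^β} u Δu`. -/
theorem weighted_uLapu_lower_bound (d : ℕ) (R β r b : ℝ) (hR : 0 < R) (hβ : 1 < β)
    (hr : R + 1 < r) (hb : R + r < b) :
    ∃ lam0 C₂ : ℝ, 1 ≤ lam0 ∧ 0 < C₂ ∧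
      ∀ lam : ℝ, lam0 < lam →
        ∀ u : EuclideanSpace ℝ (Fin (d + 1)) → ℝ, ContDiff ℝ 2 u →
          (∀ x ∈ frontier (Omega d R), u x = 0) →
          (-∫ x in Omega d R, cw d lam β r b x * u x * lap d u x) ≥
            -C₂ * lam ^ 2 * β ^ 2 * b ^ (-(2 * β)) *
                (∫ x in Omega d R,
                  (x (Fin.last d) + r) ^ (2 * β) * cw d lam β r b x * (u x) ^ 2) +
              (∫ x in Omega d R, cw d lam β r b x * ‖gradient u x‖ ^ 2) := by
  have hb0 : 0 < b := by linarith
  have hpos : ∀ t ∈ Set.Icc (-R) R, 1 < t + r := fun t ht => by linarith [ht.1]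
  refine ⟨1, 2 + b ^ β, le_rfl, by positivity, fun lam hlam u hu hu0 => ?_⟩
  let φ : ℝ → ℝ := fun t => 2 * lam * ((t + r) / b) ^ β
  let φ₁ : ℝ → ℝ := fun t => 2 * lam * (1 / b * β * ((t + r) / b) ^ (β - 1))
  let φ₂ : ℝ → ℝ := fun t =>
    2 * lam * (1 / b * β * (1 / b * (β - 1) * ((t + r) / b) ^ (β - 1 - 1)))
  have hne : ∀ t ∈ Set.Icc (-R) R, (t + r) / b ≠ 0 := fun t ht =>
    (div_pos (by linarith [hpos t ht]) hb0).ne'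
  have hbase : ∀ t, HasDerivAt (fun s => (s + r) / b) (1 / b) t := fun t =>
    ((hasDerivAt_id t).add_const r).div_const b
  have hφ : ∀ t ∈ Set.Icc (-R) R, HasDerivAt φ (φ₁ t) t := fun t ht =>
    ((hbase t).rpow_const (Or.inl (hne t ht))).const_mul (2 * lam)
  have hφ₁ : ∀ t ∈ Set.Icc (-R) R, HasDerivAt φ₁ (φ₂ t) t := fun t ht =>
    (((hbase t).rpow_const (Or.inl (hne t ht))).const_mul (1 / b * β)).const_mul (2 * lam)
  have hφc : ContinuousOn φ (Set.Icc (-R) R) := fun t ht =>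
    (hφ t ht).continuousAt.continuousWithinAt
  have hφ₁c : ContinuousOn φ₁ (Set.Icc (-R) R) := fun t ht =>
    (hφ₁ t ht).continuousAt.continuousWithinAt
  have hφ₂c : ContinuousOn φ₂ (Set.Icc (-R) R) := fun t ht =>
    (((((hbase t).rpow_const (Or.inl (hne t ht))).const_mul (1 / b * (β - 1))).const_mul
      (1 / b * β)).const_mul (2 * lam)).continuousAt.continuousWithinAt
  let g₂ : ℝ → ℝ := fun t => Real.exp (φ t) * φ₁ t * φ₁ t + Real.exp (φ t) * φ₂ t
  have hg₂c : ContinuousOn g₂ (Set.Icc (-R) R) :=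
    ((hφc.rexp.mul hφ₁c).mul hφ₁c).add (hφc.rexp.mul hφ₂c)
  have key := integral_weight_mul_lap hR (g := fun t => Real.exp (φ t)) (g₂ := g₂)
    (fun t ht => (hφ t ht).exp) (fun t ht => (hφ t ht).exp.mul (hφ₁ t ht)) hg₂c hu hu0
  have hpoint : ∀ t ∈ Set.Icc (-R) R, g₂ t / 2 ≤
      (2 + b ^ β) * lam ^ 2 * β ^ 2 * b ^ (-(2 * β)) * ((t + r) ^ (2 * β) * Real.exp (φ t)) := by
    intro t ht
    have hs := hpos t ht
    have hs0 : 0 < t + r := by linarith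
    set s := t + r with hs_def
    have hB : 0 < b ^ β := by positivity
    have hS : 1 ≤ s ^ β := Real.one_le_rpow hs.le (by linarith)
    have e0 : b ^ (-(2 * β)) * (b ^ β * b ^ β) = 1 := by
      rw [← Real.rpow_add hb0, ← Real.rpow_add hb0, ← Real.rpow_zero b]; ring_nf
    have e1 : s ^ (2 * β) = s ^ β * s ^ β := by rw [← Real.rpow_add hs0]; ring_nf
    have h1 : φ₁ t = 2 * lam * β * s ^ β / (b ^ β * s) := by
      simp only [φ₁, ← hs_def]
      rw [Real.div_rpow hs0.le hb0.le, Real.rpow_sub_one hs0.ne', Real.rpow_sub_one hb0.ne']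
      field_simp
    have h2 : φ₂ t = 2 * lam * β * (β - 1) * s ^ β / (b ^ β * s ^ 2) := by
      simp only [φ₂, ← hs_def]
      rw [Real.div_rpow hs0.le hb0.le, Real.rpow_sub_one hs0.ne', Real.rpow_sub_one hb0.ne',
        Real.rpow_sub_one hs0.ne', Real.rpow_sub_one hb0.ne']
      field_simp
    have e2 : b ^ (-(2 * β)) = 1 / (b ^ β * b ^ β) := by
      rw [eq_div_iff (by positivity), e0]
    have hmain : (φ₁ t * φ₁ t + φ₂ t) / 2 ≤
        (2 + b ^ β) * lam ^ 2 * β ^ 2 * b ^ (-(2 * β)) * s ^ (2 * β) := by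
      have b1 : φ₁ t * φ₁ t / 2 ≤ 2 * lam ^ 2 * β ^ 2 * b ^ (-(2 * β)) * s ^ (2 * β) := by
        have : φ₁ t * φ₁ t / 2 = 2 * lam ^ 2 * β ^ 2 * b ^ (-(2 * β)) * s ^ (2 * β) / s ^ 2 := by
          rw [h1, e1, e2]; field_simp
        rw [this]
        exact div_le_self (by positivity) (one_le_pow₀ hs.le)
      have b2 : φ₂ t / 2 ≤ b ^ β * lam ^ 2 * β ^ 2 * b ^ (-(2 * β)) * s ^ (2 * β) := by
        have : φ₂ t / 2 = (lam * (β * (β - 1)) * s ^ β / b ^ β) / s ^ 2 := by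
          rw [h2]; field_simp
        rw [this]
        have hβ1 : 0 ≤ β - 1 := by linarith
        refine (div_le_self (by positivity) (one_le_pow₀ hs.le)).trans ?_
        have : b ^ β * lam ^ 2 * β ^ 2 * b ^ (-(2 * β)) * s ^ (2 * β) =
            lam ^ 2 * β ^ 2 * (s ^ β * s ^ β) / b ^ β := by
          rw [e1, e2]; field_simp
        rw [this]
        have a1 : lam ≤ lam ^ 2 := by nlinarith
        have a2 : β * (β - 1) ≤ β ^ 2 := by nlinarith
        have a3 : s ^ β ≤ s ^ β * s ^ β := by nlinarith
        gcongr
      linarith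
    calc g₂ t / 2 = (φ₁ t * φ₁ t + φ₂ t) / 2 * Real.exp (φ t) := by simp only [g₂]; ring
      _ ≤ _ := (mul_le_mul_of_nonneg_right hmain (Real.exp_pos (φ t)).le).trans_eq (by ring)
  have hcl : Continuous fun x : EuclideanSpace ℝ (Fin (d + 1)) => x (Fin.last d) := by fun_prop
  have hlast : Set.MapsTo (fun x : EuclideanSpace ℝ (Fin (d + 1)) => x (Fin.last d))
      (closedCube d R) (Set.Icc (-R) R) := fun x hx => hx _
  have hpow : ContinuousOn (fun t : ℝ => (t + r) ^ (2 * β)) (Set.Icc (-R) R) :=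
    (continuousOn_id.add continuousOn_const).rpow_const fun t ht =>
      Or.inl (ne_of_gt (zero_lt_one.trans (hpos t ht)))
  have hle : ∫ x in Omega d R, g₂ (x (Fin.last d)) / 2 * u x ^ 2 ≤
      (2 + b ^ β) * lam ^ 2 * β ^ 2 * b ^ (-(2 * β)) *
        ∫ x in Omega d R, (x (Fin.last d) + r) ^ (2 * β) * cw d lam β r b x * (u x) ^ 2 := by
    rw [← integral_const_mul]
    refine setIntegral_mono_on ?_ ?_ (isOpen_Omega d R).measurableSet fun x hx => ?_
    · exact integrableOn_Omega (((hg₂c.comp hcl.continuousOn hlast).div_const 2).mul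
        (hu.continuous.pow 2).continuousOn)
    · exact (integrableOn_Omega (((hpow.mul hφc.rexp).comp hcl.continuousOn hlast).mul
        (hu.continuous.pow 2).continuousOn)).const_mul _
    · rw [← mul_assoc]
      exact mul_le_mul_of_nonneg_right
        (hpoint _ (hlast (Omega_subset_closedCube d R hx))) (sq_nonneg _)
  have hcw : ∀ x, cw d lam β r b x = Real.exp (φ (x (Fin.last d))) := fun x => rfl
  simp only [hcw] at hle ⊢
  rw [key]
  linarith
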